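/- Let Σ = (x̃,ρ,B̃) be an acyclic generalized seed ordered so that b_{ij} ≥ 0 whenever n ≥ i > j ≥ 1. Then for each i ∈ [1,n], x_i^{(n)} x_i = Σ_{r=0}^{d_i} ρ_{i,r} ∏_{j=i}^{n} x_j^{rβ_{ji}} ∏_{j=1}^{i−1} (x_j^{(i−1)})^{−rβ_{ji}} ∏_{j=n+1}^{m} x_j^{⌊[rβ^{(i−1)}_{ji}]_+⌋ + ⌊[(d_i−r)(−β^{(i−1)}_{ji})]_+⌋}, where β^{(i−1)}_{ji} = b^{(i−1)}_{ji}/d_i with B̃^{(i−1)} = μ_{i−1}⋯μ_1(B̃); consequently, the projective standard monomials in x_1, x_1^{(n)}, …, x_n, x_n^{(n)} span the lower bound generalized cluster algebra ℒ^{(n)}(Σ) = ℤℙ[x_1, x_1^{(n)}, …, x_n, x_n^{(n)}] as a ℤℙ-module. -/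

import Mathlib

open Finset

namespace GCA

/-- Ambient field: the field of rational functions `ℚ(x₁,…,x_m)`. -/
abbrev K (m : ℕ) : Type := FractionRing (MvPolynomial (Fin m) ℚ)

/-- The variables `x₁,…,x_m` inside the ambient field. -/
noncomputable def xv (m : ℕ) (j : Fin m) : K m :=
  algebraMap (MvPolynomial (Fin m) ℚ) (K m) (MvPolynomial.X j)

/-- The coefficient ring `ℤℙ`: the Laurent polynomial ring generated over `ℤ`
by the frozen variables `x_{n+1},…,x_m` and their inverses, as a subalgebra of `K m`. -/
noncomputable def ZP (m n : ℕ) : Subalgebra ℤ (K m) :=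
  Algebra.adjoin ℤ {y | ∃ j : Fin m, n ≤ (j : ℕ) ∧ (y = xv m j ∨ y = (xv m j)⁻¹)}

/-- A (generalized) seed datum: the extended cluster, strings, and the exchange matrix. -/
structure Seed (m n : ℕ) where
  x : Fin m → K m
  ρ : Fin n → ℕ → K m
  B : Matrix (Fin m) (Fin n) ℤ

variable {m n : ℕ}

/-- The exponent `⌊[rβ]₊⌋ + ⌊[−(d−r)β]₊⌋` where `β = b/d`. -/
def mutExp (d : ℕ) (b : ℤ) (r : ℕ) : ℤ :=
  ⌊max ((r : ℚ) * b / d) 0⌋ + ⌊max (-(((d : ℚ) - r) * b / d)) 0⌋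

/-- Matrix mutation in direction `i` of an `m × n` exchange matrix. -/
def matMut (hmn : n ≤ m) (i : Fin n) (B : Matrix (Fin m) (Fin n) ℤ) :
    Matrix (Fin m) (Fin n) ℤ := fun k l =>
  if k = Fin.castLE hmn i ∨ l = i then -B k l
  else B k l + (|B k i| * B (Fin.castLE hmn i) l + B k i * |B (Fin.castLE hmn i) l|) / 2

/-- The exchanged cluster variable `x'_i` of a seed. -/
noncomputable def exchangeVar (hmn : n ≤ m) (d : Fin n → ℕ) (S : Seed m n) (i : Fin n) :
    K m :=
  (S.x (Fin.castLE hmn i))⁻¹ *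
    ∑ r ∈ Finset.range (d i + 1),
      S.ρ i r * ∏ k : Fin m, S.x k ^ mutExp (d i) (S.B k i) r

/-- Seed mutation in direction `i`. -/
noncomputable def Seed.mut (hmn : n ≤ m) (d : Fin n → ℕ) (i : Fin n) (S : Seed m n) :
    Seed m n where
  x := fun j => if j = Fin.castLE hmn i then exchangeVar hmn d S i else S.x j
  ρ := fun j r => if j = i then S.ρ i (d i - r) else S.ρ j r
  B := matMut hmn i S.B

/-- Apply a finite sequence of mutations (left-most applied first). -/
noncomputable def mutSeq (hmn : n ≤ m) (d : Fin n → ℕ) : List (Fin n) → Seed m n → Seed m n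
  | [], S => S
  | i :: l, S => mutSeq hmn d l (Seed.mut hmn d i S)

/-- `seedUpTo hmn d S k = μ_k ⋯ μ_2 μ_1 (S)` (paper's direction `t ∈ [1,n]` is Lean's `t-1`). -/
noncomputable def seedUpTo (hmn : n ≤ m) (d : Fin n → ℕ) (S : Seed m n) : ℕ → Seed m n
  | 0 => S
  | k + 1 => if h : k < n then Seed.mut hmn d ⟨k, h⟩ (seedUpTo hmn d S k) else seedUpTo hmn d S k

/-- The initial seed whose cluster variables are the canonical variables of `ℚ(x₁,…,x_m)`. -/
noncomputable def initSeed (m n : ℕ) (ρ : Fin n → ℕ → K m) (B : Matrix (Fin m) (Fin n) ℤ) :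
    Seed m n := ⟨xv m, ρ, B⟩

/-- The principal part of `B` is skew-symmetrizable. -/
def SkewSymmetrizable (hmn : n ≤ m) (B : Matrix (Fin m) (Fin n) ℤ) : Prop :=
  ∃ D : Fin n → ℤ, (∀ i, 0 < D i) ∧
    ∀ i j : Fin n, D i * B (Fin.castLE hmn i) j = -(D j * B (Fin.castLE hmn j) i)

/-- `p` is a monomial in `ℤ[x_{n+1},…,x_m]`. -/
def IsFrozenMonomial (m n : ℕ) (p : K m) : Prop :=
  ∃ (c : ℤ) (e : Fin m → ℕ), (∀ j : Fin m, (j : ℕ) < n → e j = 0) ∧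
    p = (c : K m) * ∏ j : Fin m, xv m j ^ e j

/-- The defining conditions on the datum `(d, ρ, B)` of a generalized seed of geometric type. -/
structure SeedHyps (m n : ℕ) (hmn : n ≤ m) (d : Fin n → ℕ) (ρ : Fin n → ℕ → K m)
    (B : Matrix (Fin m) (Fin n) ℤ) : Prop where
  d_pos : ∀ i, 0 < d i
  d_dvd : ∀ i j : Fin n, (d i : ℤ) ∣ B (Fin.castLE hmn j) i
  skew : SkewSymmetrizable hmn B
  rho_zero : ∀ i, ρ i 0 = 1
  rho_top : ∀ i, ρ i (d i) = 1
  rho_mon : ∀ i r, r ≤ d i → IsFrozenMonomial m n (ρ i r)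

/-- The edge relation of the directed graph `Γ`: an edge from `i` to `j` iff `b_{ij} > 0`. -/
def GammaEdge (hmn : n ≤ m) (B : Matrix (Fin m) (Fin n) ℤ) (i j : Fin n) : Prop :=
  0 < B (Fin.castLE hmn i) j

/-- The directed graph `Γ` has no oriented cycle. -/
def Acyclic (hmn : n ≤ m) (B : Matrix (Fin m) (Fin n) ℤ) : Prop :=
  ∀ i : Fin n, ¬ Relation.TransGen (GammaEdge hmn B) i i

/-- The ordering normalization: `b_{ij} ≥ 0` whenever `n ≥ i > j ≥ 1`. -/
def Ordered (hmn : n ≤ m) (B : Matrix (Fin m) (Fin n) ℤ) : Prop :=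
  ∀ i j : Fin n, j < i → 0 ≤ B (Fin.castLE hmn i) j

/-- Divisibility inside a subset `R` of the ambient field. -/
def DvdIn (R : Set (K m)) (p u : K m) : Prop := ∃ z ∈ R, u = p * z

/-- `u` and `v` are coprime in `R`: every common divisor in `R` is a unit of `R`. -/
def CoprimeIn (R : Set (K m)) (u v : K m) : Prop :=
  ∀ p ∈ R, DvdIn R p u → DvdIn R p v → ∃ q ∈ R, p * q = 1

/-- The polynomial ring `ℤℙ[x₁,…,x_n]` as a subalgebra of `K m`. -/
noncomputable def polyRing (hmn : n ≤ m) : Subalgebra ℤ (K m) :=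
  Algebra.adjoin ℤ
    ({y | ∃ j : Fin m, n ≤ (j : ℕ) ∧ (y = xv m j ∨ y = (xv m j)⁻¹)} ∪
      {y | ∃ j : Fin n, y = xv m (Fin.castLE hmn j)})

/-- The seed is coprime: the exchange polynomials `x_i x'_i` are pairwise coprime
in `ℤℙ[x₁,…,x_n]`. -/
def CoprimeSeed (hmn : n ≤ m) (d : Fin n → ℕ) (S : Seed m n) : Prop :=
  ∀ i j : Fin n, i ≠ j →
    CoprimeIn (↑(polyRing hmn (m := m)) : Set (K m))
      (S.x (Fin.castLE hmn i) * exchangeVar hmn d S i)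
      (S.x (Fin.castLE hmn j) * exchangeVar hmn d S j)

/-- All cluster variables of all seeds mutation-equivalent to `S`. -/
noncomputable def clusterVars (hmn : n ≤ m) (d : Fin n → ℕ) (S : Seed m n) : Set (K m) :=
  {y | ∃ (L : List (Fin n)) (i : Fin n), y = (mutSeq hmn d L S).x (Fin.castLE hmn i)}

/-- The generalized cluster algebra `𝒜(x̃,ρ,B̃)` as a `ℤℙ`-subalgebra of `ℚ(x₁,…,x_m)`. -/
noncomputable def gca (hmn : n ≤ m) (d : Fin n → ℕ) (S : Seed m n) :
    Subalgebra (↥(ZP m n)) (K m) :=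
  Algebra.adjoin (↥(ZP m n)) (clusterVars hmn d S)

/-- The generalized projective cluster variable `x_i^{(n)}`. -/
noncomputable def projVar (hmn : n ≤ m) (d : Fin n → ℕ) (S : Seed m n) (i : Fin n) : K m :=
  (seedUpTo hmn d S n).x (Fin.castLE hmn i)

/-- The lower bound generalized cluster algebra
`ℒ^{(n)}(Σ) = ℤℙ[x₁, x₁^{(n)}, …, x_n, x_n^{(n)}]`. -/
noncomputable def lowerBound (hmn : n ≤ m) (d : Fin n → ℕ) (S : Seed m n) :
    Subalgebra (↥(ZP m n)) (K m) :=
  Algebra.adjoin (↥(ZP m n))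
    ({y | ∃ i : Fin n, y = S.x (Fin.castLE hmn i)} ∪
      {y | ∃ i : Fin n, y = projVar hmn d S i})

/-- Index type for standard monomials: exponent pairs with no product `x_i x'_i`. -/
def StdIdx (n : ℕ) : Type := {v : Fin n → ℕ × ℕ // ∀ i, (v i).1 = 0 ∨ (v i).2 = 0}

/-- The (projective) standard monomial attached to an exponent vector. -/
noncomputable def stdMon (x x' : Fin n → K m) (v : StdIdx n) : K m :=
  ∏ i : Fin n, x i ^ (v.1 i).1 * x' i ^ (v.1 i).2

/-- Lexicographic order on exponent vectors. -/
def lexLt (a b : Fin n → ℤ) : Prop :=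
  ∃ k : Fin n, a k < b k ∧ ∀ j : Fin n, j < k → a j = b j

/-- The Laurent monomial `x^a = x₁^{a₁} ⋯ x_n^{a_n}`. -/
noncomputable def xpow (hmn : n ≤ m) (a : Fin n → ℤ) : K m :=
  ∏ i : Fin n, xv m (Fin.castLE hmn i) ^ a i

/-- `x^a` is the first Laurent monomial of `Y` (with some nonzero leading
coefficient in `ℤℙ`): `Y = c_a x^a + Σ_v c_v x^v` with all `v ≺ a`. -/
def IsFirstMonomial (hmn : n ≤ m) (Y : K m) (a : Fin n → ℤ) : Prop :=
  ∃ (s : Finset (Fin n → ℤ)) (c : (Fin n → ℤ) → K m),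
    (∀ v, c v ∈ ZP m n) ∧ c a ≠ 0 ∧ (∀ v ∈ s, lexLt v a) ∧
    Y = c a * xpow hmn a + ∑ v ∈ s, c v * xpow hmn v

end GCA

namespace GCA

theorem xv_ne_zero (m : ℕ) (j : Fin m) : xv m j ≠ 0 := by
  unfold xv
  rw [Ne, FaithfulSMul.algebraMap_eq_zero_iff]
  exact MvPolynomial.X_ne_zero j

/-- Entries of the principal part are nonpositive above the diagonal. -/
theorem upper_nonpos {m n : ℕ} (hmn : n ≤ m) (B : Matrix (Fin m) (Fin n) ℤ)
    (hs : SkewSymmetrizable hmn B) (ho : Ordered hmn B) (i j : Fin n) (h : i < j) :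
    B (Fin.castLE hmn i) j ≤ 0 := by
  obtain ⟨D, hD, hDB⟩ := hs
  have h1 := hDB i j
  have h2 := ho j i h
  have h3 := hD i
  have h4 := hD j
  by_contra hc
  push Not at hc
  have := mul_pos h3 hc
  have := mul_nonneg h4.le h2
  linarith

theorem diag_zero {m n : ℕ} (hmn : n ≤ m) (B : Matrix (Fin m) (Fin n) ℤ)
    (hs : SkewSymmetrizable hmn B) (i : Fin n) :
    B (Fin.castLE hmn i) i = 0 := by
  obtain ⟨D, hD, hDB⟩ := hs
  have h1 := hDB i i
  have h3 := hD i
  have : D i * B (Fin.castLE hmn i) i = 0 := by linarith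
  rcases mul_eq_zero.1 this with h | h
  · omega
  · exact h

theorem seed_x_ge {m n : ℕ} (hmn : n ≤ m) (d : Fin n → ℕ) (S : Seed m n) (k : ℕ)
    (j : Fin m) (hj : k ≤ (j : ℕ) ∨ n ≤ (j : ℕ)) : (seedUpTo hmn d S k).x j = S.x j := by
  induction k with
  | zero => rfl
  | succ k ih =>
    rw [seedUpTo]
    split_ifs with h
    · have : j ≠ Fin.castLE hmn ⟨k, h⟩ := by
        intro e
        have := congrArg Fin.val e
        simp at this
        omega
      simp only [Seed.mut, if_neg this]
      exact ih (by omega)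
    · exact ih (by omega)

theorem seed_rho_ge {m n : ℕ} (hmn : n ≤ m) (d : Fin n → ℕ) (S : Seed m n) (k : ℕ)
    (j : Fin n) (hj : k ≤ (j : ℕ)) : (seedUpTo hmn d S k).ρ j = S.ρ j := by
  induction k with
  | zero => rfl
  | succ k ih =>
    rw [seedUpTo]
    split_ifs with h
    · have : j ≠ ⟨k, h⟩ := by
        intro e
        have := congrArg Fin.val e
        simp at this
        omega
      simp only [Seed.mut, if_neg this]
      exact ih (by omega)
    · exact ih (by omega)

theorem seed_x_lt {m n : ℕ} (hmn : n ≤ m) (d : Fin n → ℕ) (S : Seed m n) (k : ℕ)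
    (j : Fin n) (hj : (j : ℕ) + 1 ≤ k) :
    (seedUpTo hmn d S k).x (Fin.castLE hmn j) =
      exchangeVar hmn d (seedUpTo hmn d S j) j := by
  induction k with
  | zero => omega
  | succ k ih =>
    rw [seedUpTo]
    rcases Nat.lt_or_ge (j : ℕ) k with hlt | hge
    · split_ifs with h
      · have : Fin.castLE hmn j ≠ Fin.castLE hmn ⟨k, h⟩ := by
          intro e
          have := congrArg Fin.val e
          simp at this
          omega
        simp only [Seed.mut, if_neg this]
        exact ih (by omega)
      · exact ih (by omega)
    · have hk : (j : ℕ) = k := by omega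
      subst hk
      rw [dif_pos j.2]
      simp [Seed.mut]

theorem mut_aux (u v : ℤ) (hu : 0 ≤ u) (hv : v ≤ 0) : (|u| * v + u * |v|) / 2 = 0 := by
  rw [abs_of_nonneg hu, abs_of_nonpos hv]
  simp

theorem seed_B {m n : ℕ} (hmn : n ≤ m) (d : Fin n → ℕ) (S : Seed m n)
    (hs : SkewSymmetrizable hmn S.B) (ho : Ordered hmn S.B) (k : ℕ) (hk : k ≤ n)
    (i l : Fin n) :
    (seedUpTo hmn d S k).B (Fin.castLE hmn i) l =
      if ((i : ℕ) < k ↔ (l : ℕ) < k) then S.B (Fin.castLE hmn i) l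
      else -S.B (Fin.castLE hmn i) l := by
  induction k generalizing i l with
  | zero => simp [seedUpTo]
  | succ k ih =>
    have h : k < n := hk
    have ih := fun i l => ih h.le i l
    rw [seedUpTo, dif_pos h]
    simp only [Seed.mut, matMut]
    have hc : (Fin.castLE hmn i = Fin.castLE hmn ⟨k, h⟩ ∨ l = ⟨k, h⟩) ↔
        ((i : ℕ) = k ∨ (l : ℕ) = k) := by
      simp [Fin.ext_iff]
    simp only [hc]
    by_cases h1 : (i : ℕ) = k ∨ (l : ℕ) = k
    · rw [if_pos h1, ih]
      by_cases h2 : (i : ℕ) = k ∧ (l : ℕ) = k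
      · have : i = l := Fin.ext (by omega)
        subst this
        simp [diag_zero hmn S.B hs]
      · by_cases h3 : ((i : ℕ) < k ↔ (l : ℕ) < k)
        · rw [if_pos h3, if_neg (by omega)]
        · rw [if_neg h3, if_pos (by omega), neg_neg]
    · rw [if_neg h1, ih i l, mut_aux, add_zero]
      · by_cases h3 : ((i : ℕ) < k ↔ (l : ℕ) < k)
        · rw [if_pos h3, if_pos (by omega)]
        · rw [if_neg h3, if_neg (by omega)]
      · rw [ih]
        split_ifs with h4
        · simp at h4
          exact ho i ⟨k, h⟩ (by rw [Fin.lt_def]; simp; omega)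
        · simp at h4
          have := upper_nonpos hmn S.B hs ho i ⟨k, h⟩ (by rw [Fin.lt_def]; simp; omega)
          omega
      · rw [ih]
        split_ifs with h4
        · simp at h4
          exact upper_nonpos hmn S.B hs ho ⟨k, h⟩ l (by rw [Fin.lt_def]; simp; omega)
        · simp at h4
          have := ho ⟨k, h⟩ l (by rw [Fin.lt_def]; simp; omega)
          omega

theorem mutExp_of_dvd (d : ℕ) (hd : 0 < d) (b : ℤ) (r : ℕ) (hr : r ≤ d) (hb : 0 ≤ b)
    (hdvd : (d : ℤ) ∣ b) : mutExp d b r = r * (b / d) := by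
  obtain ⟨c, rfl⟩ := hdvd
  have hd' : (d : ℚ) ≠ 0 := by positivity
  have hdz : (d : ℤ) ≠ 0 := by positivity
  have hc : 0 ≤ c := by
    by_contra hc
    push Not at hc
    have := mul_neg_of_pos_of_neg (show (0 : ℤ) < d by positivity) hc
    omega
  have hcq : (0 : ℚ) ≤ c := by exact_mod_cast hc
  have hrq : (r : ℚ) ≤ d := by exact_mod_cast hr
  have e1 : ((r : ℚ) * ((d * c : ℤ) : ℚ) / d) = ((r * c : ℤ) : ℚ) := by
    push_cast; field_simp
  have e2 : (((d : ℚ) - r) * ((d * c : ℤ) : ℚ) / d) = (d - r) * c := by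
    push_cast; field_simp
  rw [mutExp, e1, e2, Int.mul_ediv_cancel_left _ hdz, max_eq_left, max_eq_right]
  · rw [Int.floor_intCast, Int.floor_zero, add_zero]
  · have : 0 ≤ ((d : ℚ) - r) * c := mul_nonneg (by linarith) hcq
    linarith
  · have : (0 : ℤ) ≤ r * c := by positivity
    exact_mod_cast this

theorem prod_split {m n : ℕ} (hmn : n ≤ m) {M : Type*} [CommMonoid M] (f : Fin m → M)
    (i : Fin n) :
    ∏ k, f k = (∏ j ∈ Finset.univ.filter (fun j : Fin n => i ≤ j), f (Fin.castLE hmn j)) *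
      (∏ j ∈ Finset.univ.filter (fun j : Fin n => j < i), f (Fin.castLE hmn j)) *
      (∏ j ∈ Finset.univ.filter (fun j : Fin m => n ≤ (j : ℕ)), f j) := by
  have h1 := Finset.prod_filter_mul_prod_filter_not (Finset.univ : Finset (Fin n))
    (fun j : Fin n => i ≤ j) (fun j => f (Fin.castLE hmn j))
  simp only [not_le] at h1
  rw [h1, ← Finset.prod_filter_mul_prod_filter_not (Finset.univ : Finset (Fin m))
    (fun j : Fin m => (j : ℕ) < n) f]
  simp only [not_lt]
  congr 1
  symm
  refine Finset.prod_bij (fun j _ => Fin.castLE hmn j) ?_ ?_ ?_ ?_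
  · intro a _; simp
  · intro a _ b _ hab
    simpa using hab
  · intro b hb
    simp at hb
    exact ⟨⟨b, hb⟩, by simp, by ext; simp⟩
  · intro a _; rfl

theorem xv_mem_ZP {m n : ℕ} (j : Fin m) (hj : n ≤ (j : ℕ)) : xv m j ∈ ZP m n :=
  Algebra.subset_adjoin ⟨j, hj, Or.inl rfl⟩

theorem xv_zpow_mem_ZP {m n : ℕ} (j : Fin m) (hj : n ≤ (j : ℕ)) (z : ℤ) :
    xv m j ^ z ∈ ZP m n := by
  have h1 : xv m j ∈ ZP m n := xv_mem_ZP j hj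
  have h2 : (xv m j)⁻¹ ∈ ZP m n := Algebra.subset_adjoin ⟨j, hj, Or.inr rfl⟩
  rcases z.eq_nat_or_neg with ⟨k, rfl | rfl⟩
  · rw [zpow_natCast]; exact pow_mem h1 k
  · rw [zpow_neg, zpow_natCast, ← inv_pow]; exact pow_mem h2 k

theorem frozen_mem_ZP {m n : ℕ} (p : K m) (hp : IsFrozenMonomial m n p) : p ∈ ZP m n := by
  obtain ⟨c, e, he, rfl⟩ := hp
  refine mul_mem (intCast_mem _ c) (prod_mem fun j _ => ?_)
  rcases Nat.lt_or_ge (j : ℕ) n with h | h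
  · rw [he j h, pow_zero]; exact one_mem _
  · exact pow_mem (xv_mem_ZP j h) _

/-- The straightening argument: if each `x_i y_i` is a combination of monomials in the
`x_j` (`j > i`) and arbitrary `y_j`, standard monomials span all monomials. -/
theorem straighten {m n : ℕ} (R : Subalgebra ℤ (K m)) (x y : Fin n → K m)
    (N : Fin n → ℕ) (c : Fin n → ℕ → K m) (p q : Fin n → ℕ → Fin n → ℕ)
    (hc : ∀ i, ∀ r ∈ Finset.range (N i), c i r ∈ R)
    (hp : ∀ i r j, j ≤ i → p i r j = 0)
    (hxy : ∀ i, x i * y i = ∑ r ∈ Finset.range (N i),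
      c i r * ((∏ j, x j ^ p i r j) * ∏ j, y j ^ q i r j)) (a : Fin n → ℕ) :
    ∀ b : Fin n → ℕ, (∏ j, x j ^ a j) * ∏ j, y j ^ b j ∈
      Submodule.span R (Set.range (stdMon x y)) := by
  have wf : WellFounded (Pi.Lex (· < ·) (fun {_ : Fin n} => ((· < ·) : ℕ → ℕ → Prop))) :=
    Pi.Lex.wellFounded (· < ·) (fun _ => wellFounded_lt)
  induction a using wf.induction with
  | _ a ih =>
  intro b
  by_cases hstd : ∀ i, a i = 0 ∨ b i = 0
  · refine Submodule.subset_span ⟨⟨fun i => (a i, b i), hstd⟩, ?_⟩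
    simp [stdMon, Finset.prod_mul_distrib]
  · push Not at hstd
    obtain ⟨i, hai, hbi⟩ := hstd
    have key : ∀ (z : Fin n → K m) (e : Fin n → ℕ), e i ≠ 0 →
        ∏ j, z j ^ e j = z i * ∏ j, z j ^ (e j - if j = i then 1 else 0) := by
      intro z e he
      have : z i = ∏ j, z j ^ (if j = i then 1 else 0) := by
        simp [Finset.prod_ite_eq', pow_ite]
      conv_rhs => rw [this]
      rw [← Finset.prod_mul_distrib]
      refine Finset.prod_congr rfl fun j _ => ?_
      rw [← pow_add]
      congr 1
      split_ifs with h
      · subst h; omega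
      · omega
    have e1 : (∏ j, x j ^ a j) * ∏ j, y j ^ b j =
        ∑ r ∈ Finset.range (N i), c i r *
          ((∏ j, x j ^ (p i r j + (a j - if j = i then 1 else 0))) *
            ∏ j, y j ^ (q i r j + (b j - if j = i then 1 else 0))) := by
      rw [key x a hai, key y b hbi, mul_mul_mul_comm, hxy, Finset.sum_mul]
      refine Finset.sum_congr rfl fun r _ => ?_
      simp only [pow_add, Finset.prod_mul_distrib]
      ring
    rw [e1]
    refine Submodule.sum_mem _ fun r hr => ?_
    have := Submodule.smul_mem (Submodule.span R (Set.range (stdMon x y)))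
      (⟨c i r, hc i r hr⟩ : R) (ih (fun j => p i r j + (a j - if j = i then 1 else 0)) ?_
        (fun j => q i r j + (b j - if j = i then 1 else 0)))
    · exact this
    · refine ⟨i, fun j hj => ?_, ?_⟩
      · simp [hp i r j hj.le, hj.ne]
      · simp [hp i r i le_rfl]; omega

theorem span_eq_adjoin {m n : ℕ} (R : Subalgebra ℤ (K m)) (x y : Fin n → K m)
    (h : ∀ a b : Fin n → ℕ, (∏ j, x j ^ a j) * ∏ j, y j ^ b j ∈
      Submodule.span R (Set.range (stdMon x y))) :
    Submodule.span R (Set.range (stdMon x y)) =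
      Subalgebra.toSubmodule (Algebra.adjoin R
        ({z | ∃ i : Fin n, z = x i} ∪ {z | ∃ i : Fin n, z = y i})) := by
  apply le_antisymm
  · rw [Submodule.span_le]
    rintro _ ⟨v, rfl⟩
    rw [SetLike.mem_coe, Subalgebra.mem_toSubmodule]
    refine prod_mem fun i _ => mul_mem (pow_mem (Algebra.subset_adjoin ?_) _)
      (pow_mem (Algebra.subset_adjoin ?_) _)
    · exact Or.inl ⟨i, rfl⟩
    · exact Or.inr ⟨i, rfl⟩
  · rw [Algebra.adjoin_eq_span, Submodule.span_le]
    intro z hz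
    have : ∃ a b : Fin n → ℕ, z = (∏ j, x j ^ a j) * ∏ j, y j ^ b j := by
      induction hz using Submonoid.closure_induction with
      | mem z hz =>
        rcases hz with ⟨i, rfl⟩ | ⟨i, rfl⟩
        · exact ⟨fun j => if j = i then 1 else 0, 0, by simp [pow_ite]⟩
        · exact ⟨0, fun j => if j = i then 1 else 0, by simp [pow_ite]⟩
      | one => exact ⟨0, 0, by simp⟩
      | mul u v _ _ hu hv =>
        obtain ⟨a, b, rfl⟩ := hu
        obtain ⟨a', b', rfl⟩ := hv
        refine ⟨a + a', b + b', ?_⟩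
        simp only [Pi.add_apply, pow_add, Finset.prod_mul_distrib]
        ring
    obtain ⟨a, b, rfl⟩ := this
    exact h a b

end GCA


open GCA in
/-- Remark 3.8. For an acyclic generalized seed ordered so that
`b_{ij} ≥ 0` whenever `i > j`, each product `x_i^{(n)} x_i` is given by the stated
exchange-type formula; consequently the projective standard monomials in
`x₁, x₁^{(n)}, …, x_n, x_n^{(n)}` span the lower bound generalized cluster algebra
`ℒ^{(n)}(Σ)` as a `ℤℙ`-module. -/
theorem projVar_mul_x_and_span {m n : ℕ} (hn : 1 ≤ n) (hmn : n ≤ m)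
    (d : Fin n → ℕ) (ρ : Fin n → ℕ → K m) (B : Matrix (Fin m) (Fin n) ℤ)
    (hseed : SeedHyps m n hmn d ρ B)
    (hacyc : Acyclic hmn B) (hord : Ordered hmn B) :
    (∀ i : Fin n,
        projVar hmn d (initSeed m n ρ B) i * xv m (Fin.castLE hmn i) =
          ∑ r ∈ Finset.range (d i + 1),
            ρ i r *
              (∏ j ∈ Finset.univ.filter (fun j : Fin n => i ≤ j),
                xv m (Fin.castLE hmn j) ^
                  ((r : ℤ) * (B (Fin.castLE hmn j) i / (d i : ℤ)))) *
              (∏ j ∈ Finset.univ.filter (fun j : Fin n => j < i),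
                ((seedUpTo hmn d (initSeed m n ρ B) (i : ℕ)).x (Fin.castLE hmn j)) ^
                  (-((r : ℤ) * (B (Fin.castLE hmn j) i / (d i : ℤ))))) *
              (∏ j ∈ Finset.univ.filter (fun j : Fin m => n ≤ (j : ℕ)),
                xv m j ^
                  (⌊max ((r : ℚ) *
                      ((seedUpTo hmn d (initSeed m n ρ B) (i : ℕ)).B j i : ℚ) /
                      (d i : ℚ)) 0⌋ +
                    ⌊max (((d i : ℚ) - (r : ℚ)) *
                      (-((seedUpTo hmn d (initSeed m n ρ B) (i : ℕ)).B j i : ℚ)) /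
                      (d i : ℚ)) 0⌋))) ∧
      Submodule.span (↥(ZP m n))
          (Set.range (stdMon (fun i => xv m (Fin.castLE hmn i))
            (projVar hmn d (initSeed m n ρ B)))) =
        Subalgebra.toSubmodule (lowerBound hmn d (initSeed m n ρ B)) := by
  have hs := hseed.skew
  have hA : ∀ i : Fin n,
        projVar hmn d (initSeed m n ρ B) i * xv m (Fin.castLE hmn i) =
          ∑ r ∈ Finset.range (d i + 1),
            ρ i r *
              (∏ j ∈ Finset.univ.filter (fun j : Fin n => i ≤ j),
                xv m (Fin.castLE hmn j) ^
                  ((r : ℤ) * (B (Fin.castLE hmn j) i / (d i : ℤ)))) *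
              (∏ j ∈ Finset.univ.filter (fun j : Fin n => j < i),
                ((seedUpTo hmn d (initSeed m n ρ B) (i : ℕ)).x (Fin.castLE hmn j)) ^
                  (-((r : ℤ) * (B (Fin.castLE hmn j) i / (d i : ℤ))))) *
              (∏ j ∈ Finset.univ.filter (fun j : Fin m => n ≤ (j : ℕ)),
                xv m j ^
                  (⌊max ((r : ℚ) *
                      ((seedUpTo hmn d (initSeed m n ρ B) (i : ℕ)).B j i : ℚ) /
                      (d i : ℚ)) 0⌋ +
                    ⌊max (((d i : ℚ) - (r : ℚ)) *
                      (-((seedUpTo hmn d (initSeed m n ρ B) (i : ℕ)).B j i : ℚ)) /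
                      (d i : ℚ)) 0⌋)) := by
    intro i
    rw [projVar, seed_x_lt hmn d _ n i (by omega), exchangeVar,
      seed_x_ge hmn d _ i (Fin.castLE hmn i) (Or.inl le_rfl), seed_rho_ge hmn d _ i i le_rfl]
    have hx0 : (initSeed m n ρ B).x (Fin.castLE hmn i) ≠ 0 := xv_ne_zero m _
    rw [mul_comm, show xv m (Fin.castLE hmn i) = (initSeed m n ρ B).x (Fin.castLE hmn i) from rfl,
      mul_inv_cancel_left₀ hx0]
    refine Finset.sum_congr rfl fun r hr => ?_
    have hr' : r ≤ d i := by
      have := Finset.mem_range.1 hr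
      omega
    rw [prod_split hmn _ i, mul_assoc, mul_assoc, mul_assoc]
    have hdz : (d i : ℤ) ≠ 0 := by have := hseed.d_pos i; omega
    congr 1
    congr 1
    · refine Finset.prod_congr rfl fun j hj => ?_
      have hj : i ≤ j := by simpa using hj
      rw [seed_x_ge hmn d _ i (Fin.castLE hmn j) (Or.inl hj),
        seed_B hmn d (initSeed m n ρ B) hs hord i i.2.le,
        if_pos (by rw [Fin.le_def] at hj; omega)]
      have hnn : 0 ≤ B (Fin.castLE hmn j) i := by
        rcases hj.lt_or_eq with h | h
        · exact hord j i h
        · subst h; rw [diag_zero hmn B hs]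
      have := mutExp_of_dvd (d i) (hseed.d_pos i) _ r hr' hnn (hseed.d_dvd i j)
      change xv m _ ^ mutExp (d i) (B (Fin.castLE hmn j) i) r = _
      rw [this]
    congr 1
    · refine Finset.prod_congr rfl fun j hj => ?_
      have hj : j < i := by simpa using hj
      rw [seed_B hmn d (initSeed m n ρ B) hs hord i i.2.le,
        if_neg (by rw [Fin.lt_def] at hj; omega)]
      have hnn : 0 ≤ -B (Fin.castLE hmn j) i := by
        have := upper_nonpos hmn B hs hord j i hj
        omega
      have := mutExp_of_dvd (d i) (hseed.d_pos i) _ r hr' hnn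
        ((dvd_neg).2 (hseed.d_dvd i j))
      change _ ^ mutExp (d i) (-B (Fin.castLE hmn j) i) r = _
      rw [this, Int.neg_ediv_of_dvd (hseed.d_dvd i j), mul_neg]
    · refine Finset.prod_congr rfl fun j hj => ?_
      have hj : n ≤ (j : ℕ) := by simpa using hj
      rw [seed_x_ge hmn d _ i j (Or.inr hj), mutExp, mul_neg, neg_div]
      rfl
  refine ⟨hA, ?_⟩
  refine span_eq_adjoin (ZP m n) _ _ fun a b => ?_
  refine straighten (ZP m n) _ _ (fun i => d i + 1)
    (fun i r => ρ i r * (∏ j ∈ Finset.univ.filter (fun j : Fin m => n ≤ (j : ℕ)),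
                xv m j ^
                  (⌊max ((r : ℚ) *
                      ((seedUpTo hmn d (initSeed m n ρ B) (i : ℕ)).B j i : ℚ) /
                      (d i : ℚ)) 0⌋ +
                    ⌊max (((d i : ℚ) - (r : ℚ)) *
                      (-((seedUpTo hmn d (initSeed m n ρ B) (i : ℕ)).B j i : ℚ)) /
                      (d i : ℚ)) 0⌋)))
    (fun i r j => if i ≤ j then ((r : ℤ) * (B (Fin.castLE hmn j) i / (d i : ℤ))).toNat else 0)
    (fun i r j => if j < i then (-((r : ℤ) * (B (Fin.castLE hmn j) i / (d i : ℤ)))).toNat else 0)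
    ?_ ?_ ?_ a b
  · intro i r hr
    have hr' : r ≤ d i := by
      have := Finset.mem_range.1 hr
      omega
    refine mul_mem (frozen_mem_ZP _ (hseed.rho_mon i r hr')) (prod_mem fun j hj => ?_)
    exact xv_zpow_mem_ZP j (by simpa using hj) _
  · intro i r j hj
    rcases hj.lt_or_eq with h | h
    · exact if_neg (not_le.2 h)
    · subst h
      simp [diag_zero hmn B hs]
  · intro i
    rw [mul_comm, hA i]
    refine Finset.sum_congr rfl fun r hr => ?_
    have e1 : (∏ j ∈ Finset.univ.filter (fun j : Fin n => i ≤ j),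
                xv m (Fin.castLE hmn j) ^
                  ((r : ℤ) * (B (Fin.castLE hmn j) i / (d i : ℤ)))) =
        ∏ j : Fin n, xv m (Fin.castLE hmn j) ^ (if i ≤ j then
          ((r : ℤ) * (B (Fin.castLE hmn j) i / (d i : ℤ))).toNat else 0) := by
      rw [Finset.prod_filter]
      refine Finset.prod_congr rfl fun j _ => ?_
      split_ifs with h
      · have hnn : 0 ≤ B (Fin.castLE hmn j) i := by
          rcases h.lt_or_eq with h | h
          · exact hord j i h
          · subst h; rw [diag_zero hmn B hs]
        have : 0 ≤ (r : ℤ) * (B (Fin.castLE hmn j) i / (d i : ℤ)) :=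
          mul_nonneg (by positivity) (Int.ediv_nonneg hnn (by positivity))
        rw [← zpow_natCast, Int.toNat_of_nonneg this]
      · simp
    have e2 : (∏ j ∈ Finset.univ.filter (fun j : Fin n => j < i),
                ((seedUpTo hmn d (initSeed m n ρ B) (i : ℕ)).x (Fin.castLE hmn j)) ^
                  (-((r : ℤ) * (B (Fin.castLE hmn j) i / (d i : ℤ))))) =
        ∏ j : Fin n, projVar hmn d (initSeed m n ρ B) j ^ (if j < i then
          (-((r : ℤ) * (B (Fin.castLE hmn j) i / (d i : ℤ)))).toNat else 0) := by
      rw [Finset.prod_filter]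
      refine Finset.prod_congr rfl fun j _ => ?_
      split_ifs with h
      · have hnn : 0 ≤ -B (Fin.castLE hmn j) i := by
          have := upper_nonpos hmn B hs hord j i h
          omega
        have : 0 ≤ -((r : ℤ) * (B (Fin.castLE hmn j) i / (d i : ℤ))) := by
          rw [← mul_neg, ← Int.neg_ediv_of_dvd (hseed.d_dvd i j)]
          exact mul_nonneg (by positivity) (Int.ediv_nonneg hnn (by positivity))
        rw [← zpow_natCast, Int.toNat_of_nonneg this, projVar,
          seed_x_lt hmn d _ n j (by omega), seed_x_lt hmn d _ i j h]
      · simp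
    rw [e1, e2]
    ring
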